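/- Let D be a probability distribution over X × [n] such that ν, the law of η(X) on Δ_n, is absolutely continuous with respect to the uniform probability measure μ on Δ_n, and let G ∈ ℝ^{n×n} be such that no two columns of G are identical. Then the set of maximizers of ⟨G, C⟩ over C in the closure of C_D (in ℝ^{n×n}) equals the set of maximizers of ⟨G, C⟩ over C ∈ C_D, and this common set is a singleton; in particular, the linear functional C ↦ ⟨G, C⟩ attains its maximum over the closure of C_D at a unique point, and this point belongs to C_D. -/

import Mathlib

open MeasureTheory Filter
open scoped ENNReal NNReal

noncomputable section

namespace Paper

variable {X : Type*} [MeasurableSpace X]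

/-- `n × n` real matrices, as functions. -/
abbrev Mat (n : ℕ) := Fin n → Fin n → ℝ

/-- A randomized classifier: a measurable map into the probability simplex. -/
def IsClassifier {n : ℕ} (h : X → Fin n → ℝ) : Prop :=
  Measurable h ∧ ∀ x, h x ∈ stdSimplex ℝ (Fin n)

/-- Confusion matrix: `conf(h,D)_{ij} = E[h_j(X) 1(Y = i)]`. -/
def conf {n : ℕ} (h : X → Fin n → ℝ) (D : Measure (X × Fin n)) : Mat n :=
  fun i j => ∫ z, (if z.2 = i then h z.1 j else 0) ∂D

/-- The set of feasible confusion matrices. -/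
def feasibleConfs {n : ℕ} (D : Measure (X × Fin n)) : Set (Mat n) :=
  {C | ∃ h : X → Fin n → ℝ, IsClassifier h ∧ C = conf h D}

/-- Entrywise inner product of matrices. -/
def minner {n : ℕ} (A B : Mat n) : ℝ := ∑ i, ∑ j, A i j * B i j

/-- Entrywise ℓ1 norm of a matrix. -/
def l1 {n : ℕ} (A : Mat n) : ℝ := ∑ i, ∑ j, |A i j|

/-- ℓ1 distance between vectors. -/
def l1dist {n : ℕ} (p q : Fin n → ℝ) : ℝ := ∑ i, |p i - q i|

/-- The matrix with a single `1` entry at `(i,j)`. -/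
def single {n : ℕ} (i j : Fin n) : Mat n := fun k l => if k = i ∧ l = j then 1 else 0

/-- Gradient of `ψ` at `C`, as a matrix of partial derivatives. -/
def grad {n : ℕ} (ψ : Mat n → ℝ) (C : Mat n) : Mat n :=
  fun i j => fderiv ℝ ψ C (single i j)

/-- The cube `[0,1]^{n×n}`. -/
def unitCube (n : ℕ) : Set (Mat n) := {C | ∀ i j, C i j ∈ Set.Icc (0:ℝ) 1}

/-- Marginal of `D` on the instance space. -/
def marginalX {n : ℕ} (D : Measure (X × Fin n)) : Measure X := D.map Prod.fst

/-- `η` is (a version of) the vector of conditional class probabilities under `D`. -/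
def IsCondProb {n : ℕ} (D : Measure (X × Fin n)) (η : X → Fin n → ℝ) : Prop :=
  Measurable η ∧ (∀ x, η x ∈ stdSimplex ℝ (Fin n)) ∧
  ∀ (i : Fin n) (A : Set X), MeasurableSet A →
    ∫ x in A, η x i ∂(marginalX D) = (D (A ×ˢ ({i} : Set (Fin n)))).toReal

/-- The law `ν` of `η(X)`. -/
def etaLaw {n : ℕ} (D : Measure (X × Fin n)) (η : X → Fin n → ℝ) : Measure (Fin n → ℝ) :=
  (marginalX D).map η

/-- The uniform (normalized Hausdorff) base measure on the probability simplex. -/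
def uniformSimplex (n : ℕ) : Measure (Fin n → ℝ) :=
  (μH[(n : ℝ) - 1]).restrict (stdSimplex ℝ (Fin n))

/-- Assumption A: the law of `η(X)` is absolutely continuous w.r.t. the uniform
measure on the simplex. -/
def AssumptionA {n : ℕ} (D : Measure (X × Fin n)) (η : X → Fin n → ℝ) : Prop :=
  etaLaw D η ≪ uniformSimplex n

/-- Assumption B: `ψ` is continuous, differentiable and bounded over the feasible
confusion matrices, strictly increasing in diagonal entries, non-increasing in
off-diagonal entries. -/
def AssumptionB {n : ℕ} (ψ : Mat n → ℝ) (D : Measure (X × Fin n)) : Prop :=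
  ContinuousOn ψ (feasibleConfs D) ∧
  (∀ C ∈ feasibleConfs D, DifferentiableAt ℝ ψ C) ∧
  (∃ B : ℝ, ∀ C ∈ feasibleConfs D, |ψ C| ≤ B) ∧
  (∀ C ∈ unitCube n, ∀ (i : Fin n), ∀ t : ℝ, 0 < t →
      C + t • single i i ∈ unitCube n → ψ C < ψ (C + t • single i i)) ∧
  (∀ C ∈ unitCube n, ∀ (i j : Fin n), i ≠ j → ∀ t : ℝ, 0 < t →
      C + t • single i j ∈ unitCube n → ψ (C + t • single i j) ≤ ψ C)

/-- Largest index among the maximizers of `s` (ties broken towards larger indices). -/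
def argmaxIdx {n : ℕ} [NeZero n] (s : Fin n → ℝ) : Fin n := by
  classical
  exact (Finset.univ.filter fun y => ∀ y', s y' ≤ s y).max' (by
    haveI : Nonempty (Fin n) := ⟨⟨0, Nat.pos_of_ne_zero (NeZero.ne n)⟩⟩
    obtain ⟨b, hb⟩ := Finite.exists_max s
    exact ⟨b, Finset.mem_filter.mpr ⟨Finset.mem_univ _, hb⟩⟩)

/-- The scores `y ↦ g_y^T p` of the columns of a gain matrix. -/
def colScore {n : ℕ} (G : Mat n) (p : Fin n → ℝ) : Fin n → ℝ := fun y => ∑ k, G k y * p k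

/-- The scores `y ↦ (G p)_y` of the rows of a gain matrix. -/
def rowScore {n : ℕ} (G : Mat n) (p : Fin n → ℝ) : Fin n → ℝ := fun y => ∑ k, G y k * p k

/-- The plug-in (deterministic) classifier induced by gain matrix `G` on a
class-probability model `ηh`. -/
def plugIn {n : ℕ} [NeZero n] (G : Mat n) (ηh : X → Fin n → ℝ) : X → Fin n → ℝ :=
  fun x i => if i = argmaxIdx (colScore G (ηh x)) then 1 else 0

/-- The deterministic classifier `x ↦ argmax_y [G μ(x)]_y` (largest index tie-break). -/
def plugInRow {n : ℕ} [NeZero n] (G : Mat n) (f : X → Fin n → ℝ) : X → Fin n → ℝ :=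
  fun x i => if i = argmaxIdx (rowScore G (f x)) then 1 else 0

/-- Empirical measure of a finite sample. -/
def empMeasure {Z : Type*} [MeasurableSpace Z] {m : ℕ} (S : Fin m → Z) : Measure Z :=
  (m : ℝ≥0∞)⁻¹ • ∑ i : Fin m, Measure.dirac (S i)

/-- The distribution of an i.i.d. sample of size `m` from `D`. -/
def iidSample {Z : Type*} [MeasurableSpace Z] (D : Measure Z) (m : ℕ) :
    Measure (Fin m → Z) :=
  Measure.pi fun _ => D

lemma floor_split_le (a : ℝ) (ha : 0 ≤ a) (m : ℕ) : ⌊(1 - a) * (m : ℝ)⌋₊ ≤ m := by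
  calc ⌊(1 - a) * (m : ℝ)⌋₊ ≤ ⌊(m : ℝ)⌋₊ := by
        apply Nat.floor_le_floor
        nlinarith [mul_nonneg ha (Nat.cast_nonneg (α := ℝ) m)]
    _ = m := Nat.floor_natCast m

/-- First part of the sample (size `m₁`). -/
def firstPart {Z : Type*} {m : ℕ} (m₁ : ℕ) (h : m₁ ≤ m) (S : Fin m → Z) : Fin m₁ → Z :=
  fun i => S (Fin.castLE h i)

/-- Last part of the sample (size `m - m₁`). -/
def lastPart {Z : Type*} {m : ℕ} (m₁ : ℕ) (h : m₁ ≤ m) (S : Fin m → Z) :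
    Fin (m - m₁) → Z :=
  fun i => S ⟨m₁ + i.1, by have := i.2; omega⟩

/-- The first `⌊(1-a) m⌋` examples of the sample (training part `S'`). -/
def splitFirst {Z : Type*} (a : ℝ) (ha : 0 ≤ a) {m : ℕ} (S : Fin m → Z) :
    Fin ⌊(1 - a) * (m : ℝ)⌋₊ → Z :=
  firstPart _ (floor_split_le a ha m) S

/-- The remaining `m - ⌊(1-a) m⌋ = ⌈a m⌉` examples of the sample (validation part `S''`). -/
def splitLast {Z : Type*} (a : ℝ) (ha : 0 ≤ a) {m : ℕ} (S : Fin m → Z) :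
    Fin (m - ⌊(1 - a) * (m : ℝ)⌋₊) → Z :=
  lastPart _ (floor_split_le a ha m) S

/-- Expected ℓ1 estimation error of a class-probability model. -/
def cpeErr {n : ℕ} (D : Measure (X × Fin n)) (η ηh : X → Fin n → ℝ) : ℝ :=
  ∫ x, l1dist (ηh x) (η x) ∂(marginalX D)

/-- Optimal value `P*_D` of the performance metric over randomized classifiers. -/
def Pstar {n : ℕ} (ψ : Mat n → ℝ) (D : Measure (X × Fin n)) : ℝ :=
  sSup {r | ∃ h : X → Fin n → ℝ, IsClassifier h ∧ r = ψ (conf h D)}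

/-- `L`-Lipschitz with respect to the entrywise ℓ1 norm on a set of matrices. -/
def LipschitzL1On {n : ℕ} (L : ℝ) (ψ : Mat n → ℝ) (s : Set (Mat n)) : Prop :=
  ∀ C₁ ∈ s, ∀ C₂ ∈ s, |ψ C₁ - ψ C₂| ≤ L * l1 (C₁ - C₂)

/-- `β`-smooth with respect to the ℓ1 norm on a set of matrices: gradients are
`β`-Lipschitz from ℓ1 to ℓ∞. -/
def SmoothL1On {n : ℕ} (β : ℝ) (ψ : Mat n → ℝ) (s : Set (Mat n)) : Prop :=
  ∀ C₁ ∈ s, ∀ C₂ ∈ s, ∀ i j, |grad ψ C₁ i j - grad ψ C₂ i j| ≤ β * l1 (C₁ - C₂)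

/-- Largest value of a vector. -/
def top1 {n : ℕ} (v : Fin n → ℝ) : ℝ := sSup (Set.range v)

/-- Second-largest value (with multiplicity) of a vector. -/
def top2 {n : ℕ} (v : Fin n → ℝ) : ℝ :=
  sSup {r | ∃ y y', y ≠ y' ∧ r = min (v y) (v y')}

/-- One step of the BayesCG (sample-based conditional gradient) recursion:
`hs` is a run of the algorithm applied to `ψ` with `T` iterations, sample `S`
and split parameter `a`. -/
def BayesCGRun {n : ℕ} [NeZero n] (a : ℝ) (ha : 0 ≤ a) (ψ : Mat n → ℝ)
    (cpe : ∀ k : ℕ, (Fin k → X × Fin n) → X → Fin n → ℝ)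
    (m T : ℕ) (S : Fin m → X × Fin n) (hs : ℕ → X → Fin n → ℝ) : Prop :=
  IsClassifier (hs 0) ∧
  ∀ j : ℕ, 1 ≤ j → j ≤ T →
    hs j = fun x i =>
      (1 - 2 / ((j : ℝ) + 1)) * hs (j - 1) x i +
        (2 / ((j : ℝ) + 1)) *
          plugIn (grad ψ (conf (hs (j - 1)) (empMeasure (splitLast a ha S))))
            (cpe _ (splitFirst a ha S)) x i


/-! ## Statement 17 -/


/-- A nontrivial linear equation cuts out a null subset of the simplex. -/
lemma uniformSimplex_hyperplane {n : ℕ} (hn : 2 ≤ n) (c : Fin n → ℝ) (hc : c ≠ 0) :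
    uniformSimplex n {p | ∑ k, c k * p k = 0} = 0 := by
  have hmeas : MeasurableSet {p : Fin n → ℝ | ∑ k, c k * p k = 0} :=
    measurableSet_eq_fun (by fun_prop) measurable_const
  rw [uniformSimplex, Measure.restrict_apply hmeas]
  rcases Set.eq_empty_or_nonempty ({p : Fin n → ℝ | ∑ k, c k * p k = 0} ∩ stdSimplex ℝ (Fin n))
    with he | ⟨p₀, hp₀c, hp₀⟩
  · rw [he, measure_empty]
  have hp₀c : ∑ k, c k * p₀ k = 0 := hp₀c
  let σ : (Fin n → ℝ) →ₗ[ℝ] ℝ := Fintype.linearCombination ℝ (fun _ => (1 : ℝ))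
  let κ : (Fin n → ℝ) →ₗ[ℝ] ℝ := Fintype.linearCombination ℝ c
  have hσ : ∀ p, σ p = ∑ k, p k := fun p => by simp [σ, Fintype.linearCombination_apply]
  have hκ : ∀ p, κ p = ∑ k, c k * p k := fun p => by
    simp [κ, Fintype.linearCombination_apply, mul_comm]
  obtain ⟨i, j, hij⟩ : ∃ i j, c i ≠ c j := by
    by_contra! h
    apply hc
    funext i
    have h1 : ∑ k, c k * p₀ k = c i := by
      rw [Finset.sum_congr rfl fun k _ => by rw [h k i], ← Finset.mul_sum, hp₀.2, mul_one]
    simpa using h1.symm.trans hp₀c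
  let K : Submodule ℝ (Fin n → ℝ) := LinearMap.ker σ ⊓ LinearMap.ker κ
  have hK1 : K < LinearMap.ker σ := by
    refine lt_of_le_of_ne inf_le_left fun h => hij ?_
    have hv : (Pi.single i 1 - Pi.single j 1 : Fin n → ℝ) ∈ LinearMap.ker σ := by
      simp [hσ]
    rw [← h] at hv
    have := hv.2
    simp only [SetLike.mem_coe, LinearMap.mem_ker, hκ, Pi.sub_apply, mul_sub,
      Finset.sum_sub_distrib] at this
    simp [Pi.single_apply] at this
    linarith
  have hK2 : LinearMap.ker σ < ⊤ := by
    refine lt_top_iff_ne_top.2 fun h => ?_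
    have hv : (Pi.single i 1 : Fin n → ℝ) ∈ LinearMap.ker σ := h ▸ Submodule.mem_top
    simp [hσ] at hv
  have h1 := Submodule.finrank_lt_finrank_of_lt hK1
  have h2 := Submodule.finrank_lt hK2.ne
  rw [Module.finrank_fin_fun] at h2
  have hsub : {p : Fin n → ℝ | ∑ k, c k * p k = 0} ∩ stdSimplex ℝ (Fin n) ⊆
      (fun v : K => (v : Fin n → ℝ) + p₀) '' Set.univ := by
    rintro p ⟨hpc, hp⟩
    have hpc : ∑ k, c k * p k = 0 := hpc
    refine ⟨⟨p - p₀, ?_, ?_⟩, trivial, by simp⟩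
    · simp [hσ, hp.2, hp₀.2]
    · simp [hκ, mul_sub, hpc, hp₀c]
  have hiso : Isometry (fun v : K => (v : Fin n → ℝ) + p₀) :=
    (isometry_add_right p₀).comp isometry_subtype_coe
  refine measure_mono_null hsub ?_
  have hcast : ((n : ℝ) - 1) = (((n - 1 : ℕ) : ℝ≥0) : ℝ) := by
    rw [NNReal.coe_natCast, Nat.cast_sub (by omega), Nat.cast_one]
  rw [hcast]
  apply hausdorffMeasure_of_dimH_lt
  rw [hiso.dimH_image, Real.dimH_univ_eq_finrank]
  have : Module.finrank ℝ K < n - 1 := by omega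
  exact_mod_cast this

lemma le_argmaxIdx {n : ℕ} [NeZero n] (s : Fin n → ℝ) (y : Fin n) : s y ≤ s (argmaxIdx s) := by
  classical
  exact (Finset.mem_filter.1 (Finset.max'_mem (Finset.univ.filter fun y => ∀ y', s y' ≤ s y) _)).2 y

lemma argmaxIdx_eq_iff {n : ℕ} [NeZero n] (s : Fin n → ℝ) (y : Fin n) :
    argmaxIdx s = y ↔ (∀ y', s y' ≤ s y) ∧ ∀ z, (∀ y', s y' ≤ s z) → z ≤ y := by
  classical
  have hmax : ∀ z, (∀ y', s y' ≤ s z) → z ≤ argmaxIdx s := fun z hz =>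
    Finset.le_max' (Finset.univ.filter fun y => ∀ y', s y' ≤ s y) z (by simpa using hz)
  constructor
  · rintro rfl
    exact ⟨le_argmaxIdx s, hmax⟩
  · rintro ⟨h1, h2⟩
    exact le_antisymm (h2 _ (le_argmaxIdx s)) (hmax _ h1)

lemma measurable_argmaxIdx {n : ℕ} [NeZero n] : Measurable (argmaxIdx (n := n)) := by
  refine measurable_to_countable' fun y => ?_
  have : argmaxIdx ⁻¹' {y} = {s : Fin n → ℝ | (∀ y', s y' ≤ s y) ∧
      ∀ z, (∀ y', s y' ≤ s z) → z ≤ y} := by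
    ext s
    simp [argmaxIdx_eq_iff]
  rw [this]
  have hm : ∀ z : Fin n, MeasurableSet {s : Fin n → ℝ | ∀ y', s y' ≤ s z} := fun z => by
    rw [Set.ofPred_forall]
    exact MeasurableSet.iInter fun y' =>
      measurableSet_le (measurable_pi_apply _) (measurable_pi_apply _)
  refine (hm y).inter (?_ : MeasurableSet {s : Fin n → ℝ | ∀ z, (∀ y', s y' ≤ s z) → z ≤ y})
  rw [Set.ofPred_forall]
  refine MeasurableSet.iInter fun z => ?_
  simp only [imp_iff_not_or]
  exact (hm z).compl.union (MeasurableSet.const _)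

lemma measurable_colScore {n : ℕ} (G : Mat n) : Measurable (colScore G) := by
  unfold colScore
  fun_prop

lemma isClassifier_plugIn {n : ℕ} [NeZero n] (G : Mat n) {η : X → Fin n → ℝ}
    (hη : Measurable η) : IsClassifier (plugIn G η) := by
  refine ⟨measurable_pi_iff.2 fun i => ?_, fun x => ⟨fun i => ?_, ?_⟩⟩
  · refine Measurable.ite ?_ measurable_const measurable_const
    have hm := measurable_argmaxIdx.comp ((measurable_colScore G).comp hη)
    exact measurableSet_eq_fun measurable_const hm
  · unfold plugIn
    split_ifs <;> norm_num
  · simp [plugIn]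

/-- Expectations of `f(X) 1(Y = i)` are computed by conditioning on `X`. -/
lemma integral_ite_eq {n : ℕ} {D : Measure (X × Fin n)} [IsProbabilityMeasure D]
    {η : X → Fin n → ℝ} (hη : IsCondProb D η) {f : X → ℝ} (hf : Measurable f) (i : Fin n) :
    ∫ z, (if z.2 = i then f z.1 else 0) ∂D = ∫ x, η x i * f x ∂(marginalX D) := by
  have : IsProbabilityMeasure (marginalX D) :=
    Measure.isProbabilityMeasure_map measurable_fst.aemeasurable
  have hηi : Measurable fun x => η x i := (measurable_pi_apply i).comp hη.1
  have hS : MeasurableSet {z : X × Fin n | z.2 = i} :=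
    measurableSet_eq_fun measurable_snd measurable_const
  have hint : Integrable (fun x => η x i) (marginalX D) :=
    Integrable.of_bound hηi.aestronglyMeasurable 1 (Eventually.of_forall fun x => by
      have := mem_Icc_of_mem_stdSimplex (hη.2.1 x) i
      rw [Real.norm_eq_abs, abs_of_nonneg this.1]
      exact this.2)
  have hmeas : (D.restrict {z | z.2 = i}).map Prod.fst =
      (marginalX D).withDensity fun x => ENNReal.ofReal (η x i) := by
    ext A hA
    rw [Measure.map_apply measurable_fst hA, Measure.restrict_apply (measurable_fst hA),
      withDensity_apply _ hA, ← ofReal_integral_eq_lintegral_ofReal hint.integrableOn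
        (Eventually.of_forall fun x => (hη.2.1 x).1 i), hη.2.2 i A hA,
      ENNReal.ofReal_toReal (measure_ne_top _ _)]
    congr 1
  calc ∫ z, (if z.2 = i then f z.1 else 0) ∂D
      = ∫ z in {z | z.2 = i}, f z.1 ∂D := by
        rw [← integral_indicator hS]
        simp only [Set.indicator_apply, Set.mem_ofPred_eq]
    _ = ∫ x, f x ∂((D.restrict {z | z.2 = i}).map Prod.fst) :=
        (integral_map measurable_fst.aemeasurable hf.aestronglyMeasurable).symm
    _ = ∫ x, η x i * f x ∂(marginalX D) := by
        rw [hmeas, integral_withDensity_eq_integral_toReal_smul hηi.ennreal_ofReal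
          (Eventually.of_forall fun _ => ENNReal.ofReal_lt_top)]
        refine integral_congr_ae (Eventually.of_forall fun x => ?_)
        simp [ENNReal.toReal_ofReal ((hη.2.1 x).1 i)]

lemma conf_apply {n : ℕ} {D : Measure (X × Fin n)} [IsProbabilityMeasure D]
    {η h : X → Fin n → ℝ} (hη : IsCondProb D η) (hh : Measurable h) (i j : Fin n) :
    conf h D i j = ∫ x, η x i * h x j ∂(marginalX D) :=
  integral_ite_eq hη (measurable_pi_iff.1 hh j) i

/-- The gain lost by replacing a maximizing vertex by another point of the simplex. -/
lemma sum_mul_vertex_sub {n : ℕ} {s p : Fin n → ℝ} (hp : p ∈ stdSimplex ℝ (Fin n)) (y : Fin n) :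
    ∑ k, s k * ((if k = y then 1 else 0) - p k) = ∑ k, p k * (s y - s k) := by
  have : ∑ k, p k * s y = s y := by rw [← Finset.sum_mul, hp.2, one_mul]
  simp only [mul_sub, Finset.sum_sub_distrib, this]
  simp [mul_comm]

lemma abs_sub_vertex_le {n : ℕ} {s p : Fin n → ℝ} (hp : p ∈ stdSimplex ℝ (Fin n)) {y : Fin n}
    (hy : ∀ k, s k ≤ s y) {δ : ℝ} (hδ : 0 < δ) (hgap : ∀ k, k ≠ y → δ ≤ |s k - s y|)
    (j : Fin n) :
    |p j - (if j = y then 1 else 0)| ≤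
      δ⁻¹ * ∑ k, s k * ((if k = y then 1 else 0) - p k) := by
  rw [sum_mul_vertex_sub hp]
  have h1 : δ * (1 - p y) ≤ ∑ k, p k * (s y - s k) := by
    calc δ * (1 - p y) = ∑ k, p k * (δ * (1 - if k = y then 1 else 0)) := by
          have : ∑ k, p k * δ = δ := by rw [← Finset.sum_mul, hp.2, one_mul]
          simp only [mul_sub, Finset.sum_sub_distrib, mul_one, this]
          simp [mul_comm]
      _ ≤ _ := by
          refine Finset.sum_le_sum fun k _ => mul_le_mul_of_nonneg_left ?_ (hp.1 k)
          split_ifs with hk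
          · simp [hk]
          · have := hgap k hk
            rw [abs_of_nonpos (sub_nonpos.2 (hy k))] at this
            linarith
  have h2 : |p j - (if j = y then 1 else 0)| ≤ 1 - p y := by
    split_ifs with hj
    · rw [hj, abs_sub_comm, abs_of_nonneg]
      linarith [(mem_Icc_of_mem_stdSimplex hp y).2]
    · rw [sub_zero, abs_of_nonneg (hp.1 j)]
      have := Finset.sum_le_univ_sum_of_nonneg (s := {j, y}) hp.1
      rw [Finset.sum_pair hj, hp.2] at this
      linarith
  refine h2.trans ?_
  rw [le_inv_mul_iff₀ hδ]
  exact h1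

/-- The points at which two scores are within `δ` of each other. -/
def nearTie {n : ℕ} (G : Mat n) (η : X → Fin n → ℝ) (δ : ℝ) : Set X :=
  {x | ∃ y y' : Fin n, y ≠ y' ∧ |colScore G (η x) y - colScore G (η x) y'| < δ}

lemma measurableSet_nearTie {n : ℕ} (G : Mat n) {η : X → Fin n → ℝ} (hη : Measurable η) (δ : ℝ) :
    MeasurableSet (nearTie G η δ) := by
  have hs : ∀ y, Measurable fun x => colScore G (η x) y := fun y =>
    (measurable_pi_apply y).comp ((measurable_colScore G).comp hη)
  simp only [nearTie, Set.ofPred_exists, Set.ofPred_and]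
  refine MeasurableSet.iUnion fun y => MeasurableSet.iUnion fun y' =>
    (MeasurableSet.const _).inter (measurableSet_lt ?_ measurable_const)
  exact ((hs y).sub (hs y')).abs

lemma exists_nearTie_lt {n : ℕ} (hn : 2 ≤ n) {D : Measure (X × Fin n)} [IsProbabilityMeasure D]
    {η : X → Fin n → ℝ} (hη : IsCondProb D η) (habs : etaLaw D η ≪ uniformSimplex n) {G : Mat n}
    (hGcols : ∀ y y' : Fin n, y ≠ y' → (fun k => G k y) ≠ (fun k => G k y'))
    {ε : ℝ} (hε : 0 < ε) :
    ∃ δ : ℝ, 0 < δ ∧ (marginalX D).real (nearTie G η δ) < ε := by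
  have : IsProbabilityMeasure (marginalX D) :=
    Measure.isProbabilityMeasure_map measurable_fst.aemeasurable
  have hlim := tendsto_measure_iInter_atTop (μ := marginalX D)
    (s := fun m : ℕ => nearTie G η (1 / ((m : ℝ) + 1)))
    (fun m => (measurableSet_nearTie G hη.1 _).nullMeasurableSet)
    (fun m m' hmm x => by
      rintro ⟨y, y', hne, h⟩
      exact ⟨y, y', hne, h.trans_le (Nat.one_div_le_one_div hmm)⟩)
    ⟨0, measure_ne_top _ _⟩
  have hnull : marginalX D (⋂ m : ℕ, nearTie G η (1 / ((m : ℝ) + 1))) = 0 := by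
    have hties : ∀ y y' : Fin n, y ≠ y' →
        marginalX D {x | ∑ k, (G k y - G k y') * η x k = 0} = 0 := fun y y' hne => by
      have h0 := habs (uniformSimplex_hyperplane hn (fun k => G k y - G k y') fun h =>
        hGcols y y' hne (funext fun k => sub_eq_zero.1 (congrFun h k)))
      rwa [etaLaw, Measure.map_apply hη.1
        (measurableSet_eq_fun (by fun_prop) measurable_const)] at h0
    refine measure_mono_null (t := ⋃ y : Fin n, ⋃ y' : Fin n, ⋃ _ : y ≠ y',
      {x | ∑ k, (G k y - G k y') * η x k = 0}) (fun x hx => ?_) ?_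
    · by_contra hcon
      simp only [Set.mem_iUnion, Set.mem_ofPred_eq, not_exists, sub_mul,
        Finset.sum_sub_distrib] at hcon
      have hev : ∀ᶠ m : ℕ in atTop, ∀ y y' : Fin n, y ≠ y' →
          1 / ((m : ℝ) + 1) < |colScore G (η x) y - colScore G (η x) y'| := by
        simp only [eventually_all]
        intro y y' hne
        exact tendsto_one_div_add_atTop_nhds_zero_nat.eventually_lt_const
          (abs_pos.2 (hcon y y' hne))
      obtain ⟨m, hm⟩ := hev.exists
      obtain ⟨y, y', hne, h⟩ := Set.mem_iInter.1 hx m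
      exact (hm y y' hne).not_gt h
    · simp only [measure_iUnion_null_iff]
      exact hties
  rw [hnull] at hlim
  obtain ⟨m, hm⟩ := (hlim.eventually_lt_const (ENNReal.ofReal_pos.2 hε)).exists
  exact ⟨1 / ((m : ℝ) + 1), Nat.one_div_pos_of_nat,
    (ENNReal.lt_ofReal_iff_toReal_lt (measure_ne_top _ _)).1 hm⟩

lemma integrable_mul_classifier {n : ℕ} {μ : Measure X} [IsFiniteMeasure μ]
    {η h : X → Fin n → ℝ} (hη : IsClassifier η) (hh : IsClassifier h) (i j : Fin n) :
    Integrable (fun x => η x i * h x j) μ := by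
  refine Integrable.of_bound (((measurable_pi_apply i).comp hη.1).mul
    ((measurable_pi_apply j).comp hh.1)).aestronglyMeasurable 1 (Eventually.of_forall fun x => ?_)
  have h1 := mem_Icc_of_mem_stdSimplex (hη.2 x) i
  have h2 := mem_Icc_of_mem_stdSimplex (hh.2 x) j
  rw [Real.norm_eq_abs, abs_of_nonneg (mul_nonneg h1.1 h2.1)]
  exact mul_le_one₀ h1.2 h2.1 h2.2

lemma integrable_colScore_mul {n : ℕ} {μ : Measure X} [IsFiniteMeasure μ]
    {η h : X → Fin n → ℝ} (hη : IsClassifier η) (hh : IsClassifier h) (G : Mat n) :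
    Integrable (fun x => ∑ j, colScore G (η x) j * h x j) μ := by
  simp only [colScore, Finset.sum_mul, mul_assoc]
  exact integrable_finsetSum _ fun j _ => integrable_finsetSum _ fun i _ =>
    (integrable_mul_classifier hη hh i j).const_mul _

lemma minner_conf {n : ℕ} {D : Measure (X × Fin n)} [IsProbabilityMeasure D]
    {η h : X → Fin n → ℝ} (hη : IsCondProb D η) (hh : IsClassifier h) (G : Mat n) :
    minner G (conf h D) = ∫ x, ∑ j, colScore G (η x) j * h x j ∂(marginalX D) := by
  have : IsProbabilityMeasure (marginalX D) :=
    Measure.isProbabilityMeasure_map measurable_fst.aemeasurable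
  have hI := fun i j => integrable_mul_classifier (μ := marginalX D) ⟨hη.1, hη.2.1⟩ hh i j
  simp only [colScore, Finset.sum_mul, mul_assoc]
  rw [integral_finsetSum _ fun j _ => integrable_finsetSum _ fun i _ => (hI i j).const_mul _,
    minner, Finset.sum_comm]
  refine Finset.sum_congr rfl fun j _ => ?_
  rw [integral_finsetSum _ fun i _ => (hI i j).const_mul _]
  refine Finset.sum_congr rfl fun i _ => ?_
  rw [integral_const_mul, conf_apply hη hh.1]

lemma colScore_regret_nonneg {n : ℕ} [NeZero n] (G : Mat n) (η : X → Fin n → ℝ)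
    {h : X → Fin n → ℝ} (hh : IsClassifier h) (x : X) :
    0 ≤ ∑ k, colScore G (η x) k * (plugIn G η x k - h x k) := by
  unfold plugIn
  rw [sum_mul_vertex_sub (hh.2 x)]
  exact Finset.sum_nonneg fun k _ =>
    mul_nonneg ((hh.2 x).1 k) (sub_nonneg.2 (le_argmaxIdx _ k))

lemma minner_plugIn_sub {n : ℕ} [NeZero n] {D : Measure (X × Fin n)} [IsProbabilityMeasure D]
    {η h : X → Fin n → ℝ} (hη : IsCondProb D η) (hh : IsClassifier h) (G : Mat n) :
    minner G (conf (plugIn G η) D) - minner G (conf h D) =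
      ∫ x, ∑ k, colScore G (η x) k * (plugIn G η x k - h x k) ∂(marginalX D) := by
  have : IsProbabilityMeasure (marginalX D) :=
    Measure.isProbabilityMeasure_map measurable_fst.aemeasurable
  have hg := isClassifier_plugIn G hη.1
  rw [minner_conf hη hh, minner_conf hη hg, ← integral_sub
    (integrable_colScore_mul ⟨hη.1, hη.2.1⟩ hg G) (integrable_colScore_mul ⟨hη.1, hη.2.1⟩ hh G)]
  simp only [mul_sub, Finset.sum_sub_distrib]

/-- Near-optimal classifiers have confusion matrices close to the plug-in one. -/
lemma abs_conf_sub_plugIn_le {n : ℕ} [NeZero n] {D : Measure (X × Fin n)} [IsProbabilityMeasure D]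
    {η h : X → Fin n → ℝ} (hη : IsCondProb D η) (hh : IsClassifier h) (G : Mat n)
    {δ : ℝ} (hδ : 0 < δ) (i j : Fin n) :
    |conf h D i j - conf (plugIn G η) D i j| ≤ (marginalX D).real (nearTie G η δ) +
      δ⁻¹ * (minner G (conf (plugIn G η) D) - minner G (conf h D)) := by
  have : IsProbabilityMeasure (marginalX D) :=
    Measure.isProbabilityMeasure_map measurable_fst.aemeasurable
  have hg := isClassifier_plugIn G hη.1
  have hη' : IsClassifier η := ⟨hη.1, hη.2.1⟩
  have hB := measurableSet_nearTie G hη.1 δ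
  have hreg : Integrable (fun x => ∑ k, colScore G (η x) k * (plugIn G η x k - h x k))
      (marginalX D) := by
    simp only [mul_sub, Finset.sum_sub_distrib]
    exact (integrable_colScore_mul hη' hg G).sub (integrable_colScore_mul hη' hh G)
  have hind : Integrable ((nearTie G η δ).indicator (1 : X → ℝ)) (marginalX D) :=
    (integrable_const (1 : ℝ)).indicator hB
  have hdiff := (integrable_mul_classifier (μ := marginalX D) hη' hh i j).sub
    (integrable_mul_classifier hη' hg i j)
  rw [minner_plugIn_sub hη hh, conf_apply hη hh.1, conf_apply hη hg.1,
    ← integral_sub (integrable_mul_classifier hη' hh i j) (integrable_mul_classifier hη' hg i j),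
    ← integral_indicator_one hB, ← integral_const_mul, ← integral_add hind (hreg.const_mul _)]
  refine abs_integral_le_integral_abs.trans
    (integral_mono hdiff.abs (hind.add (hreg.const_mul _)) fun x => ?_)
  have hx := mem_Icc_of_mem_stdSimplex (hη.2.1 x) i
  have hle : |η x i * h x j - η x i * plugIn G η x j| ≤ |h x j - plugIn G η x j| := by
    rw [← mul_sub, abs_mul, abs_of_nonneg hx.1]
    exact mul_le_of_le_one_left (abs_nonneg _) hx.2
  refine hle.trans ?_
  have hnn := mul_nonneg (inv_nonneg.2 hδ.le) (colScore_regret_nonneg G η hh x)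
  by_cases hxB : x ∈ nearTie G η δ
  · simp only [Set.indicator_of_mem hxB, Pi.one_apply]
    have h1 := mem_Icc_of_mem_stdSimplex (hh.2 x) j
    have h2 := mem_Icc_of_mem_stdSimplex (hg.2 x) j
    have : |h x j - plugIn G η x j| ≤ 1 :=
      abs_le.2 ⟨by linarith [h1.1, h2.2], by linarith [h1.2, h2.1]⟩
    linarith
  · simp only [Set.indicator_of_notMem hxB, zero_add]
    refine abs_sub_vertex_le (hh.2 x) (le_argmaxIdx _) hδ (fun k hk => ?_) j
    by_contra! hlt
    exact hxB ⟨_, _, hk, hlt⟩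

lemma continuous_minner {n : ℕ} (G : Mat n) : Continuous (minner G) := by
  unfold minner
  fun_prop

theorem stmt17 {X : Type*} [MeasurableSpace X] {n : ℕ} (hn : 2 ≤ n)
    (D : Measure (X × Fin n)) [IsProbabilityMeasure D]
    (η : X → Fin n → ℝ) (hη : IsCondProb D η)
    (habs : etaLaw D η ≪ uniformSimplex n)
    (G : Mat n)
    (hGcols : ∀ y y' : Fin n, y ≠ y' → (fun k => G k y) ≠ (fun k => G k y')) :
    ∃ C₀ : Mat n, C₀ ∈ feasibleConfs (X := X) D ∧
      {C : Mat n | C ∈ closure (feasibleConfs (X := X) D) ∧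
          ∀ C' ∈ closure (feasibleConfs (X := X) D), minner G C' ≤ minner G C} = {C₀} ∧
      {C : Mat n | C ∈ feasibleConfs (X := X) D ∧
          ∀ C' ∈ feasibleConfs (X := X) D, minner G C' ≤ minner G C} = {C₀} := by
  have : NeZero n := ⟨by omega⟩
  have hg := isClassifier_plugIn G hη.1
  set C₀ := conf (plugIn G η) D with hC₀
  have hmem : C₀ ∈ feasibleConfs (X := X) D := ⟨_, hg, rfl⟩
  have hmax : ∀ C ∈ closure (feasibleConfs (X := X) D), minner G C ≤ minner G C₀ := by
    refine fun C hC => closure_minimal (t := {C | minner G C ≤ minner G C₀}) ?_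
      (isClosed_le (continuous_minner G) continuous_const) hC
    rintro _ ⟨h, hh, rfl⟩
    rw [Set.mem_ofPred_eq, ← sub_nonneg, hC₀, minner_plugIn_sub hη hh]
    exact integral_nonneg fun x => colScore_regret_nonneg G η hh x
  have huniq : ∀ C ∈ closure (feasibleConfs (X := X) D), minner G C₀ ≤ minner G C → C = C₀ := by
    intro C hC hle
    funext i j
    refine sub_eq_zero.1 (abs_nonpos_iff.1 (le_of_forall_pos_le_add fun ε hε => ?_))
    obtain ⟨δ, hδ, hsmall⟩ := exists_nearTie_lt hn hη habs hGcols hε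
    have hbound : |C i j - C₀ i j| ≤ (marginalX D).real (nearTie G η δ) +
        δ⁻¹ * (minner G C₀ - minner G C) := by
      have hcont := continuous_minner G
      refine closure_minimal (t := {C : Mat n | |C i j - C₀ i j| ≤
        (marginalX D).real (nearTie G η δ) + δ⁻¹ * (minner G C₀ - minner G C)}) ?_
        (isClosed_le (by fun_prop) (by fun_prop)) hC
      rintro _ ⟨h, hh, rfl⟩
      exact abs_conf_sub_plugIn_le hη hh G hδ i j
    rw [le_antisymm (hmax C hC) hle, sub_self, mul_zero] at hbound
    linarith
  refine ⟨C₀, hmem, Set.eq_singleton_iff_unique_mem.2 ⟨⟨subset_closure hmem, hmax⟩, ?_⟩,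
    Set.eq_singleton_iff_unique_mem.2 ⟨⟨hmem, fun C hC => hmax C (subset_closure hC)⟩, ?_⟩⟩
  · exact fun C hC => huniq C hC.1 (hC.2 _ (subset_closure hmem))
  · exact fun C hC => huniq C (subset_closure hC.1) (hC.2 _ hmem)

end Paper
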